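/- Let P be a point of PG(2,q²) with P ∉ U and P ∉ ℓ∞, and let t ∈ GF(q) with t ≠ 0. Then E_t(P) ∉ U and the pedals τ_P(U) and τ_{E_t(P)}(U) are disjoint. -/

import Mathlib

noncomputable section
open Projectivization
open scoped LinearAlgebra.Projectivization

/-- `Pt K` is the point set of `PG(2, q²)`, i.e. the projectivization of `K³`. -/
abbrev Pt (K : Type) [Field K] : Type := ℙ K (Fin 3 → K)

lemma vec1_ne_zero {K : Type} [Field K] (a b : K) : ![a, b, (1 : K)] ≠ 0 := by
  intro h
  have := congrFun h 2
  simp at this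

lemma vecInf_ne_zero {K : Type} [Field K] : ![(0 : K), 1, 0] ≠ 0 := by
  intro h
  have := congrFun h 1
  simp at this

lemma vec100_ne_zero {K : Type} [Field K] : ![(1 : K), 0, 0] ≠ 0 := by
  intro h
  have := congrFun h 0
  simp at this

/-- The orthogonal-Buekenhout-Metz unital
`U = {[x, αx² + βN(x) + r, 1] : x ∈ K, r ∈ GF(q)} ∪ {[0,1,0]}`,
where `GF(q) = {r : r^q = r}` and `N(x) = x^(q+1)`. -/
def unital (K : Type) [Field K] (q : ℕ) (α β : K) : Set (Pt K) :=
  {P | (∃ x r : K, r ^ q = r ∧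
      P = Projectivization.mk K ![x, α * x ^ 2 + β * x ^ (q + 1) + r, 1] (vec1_ne_zero _ _)) ∨
    P = Projectivization.mk K ![0, 1, 0] vecInf_ne_zero}

/-- The line through two points `A`, `B`: all points `[w]` with `w ∈ span{u, v}` where
`A = [u]`, `B = [v]`. -/
def lineThrough {K : Type} [Field K] (A B : Pt K) : Set (Pt K) :=
  {C | C.submodule ≤ A.submodule ⊔ B.submodule}

/-- The pedal `τ_P(U)` of `P`: the set of feet of `P`, i.e. points `A ∈ U` such that `A`
is the only point of `U` on the line through `P` and `A`. -/
def pedal {K : Type} [Field K] (U : Set (Pt K)) (P : Pt K) : Set (Pt K) :=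
  {A | A ∈ U ∧ lineThrough P A ∩ U = {A}}

/-- The line at infinity `ℓ∞ = {[a, b, 0]}`. -/
def linf (K : Type) [Field K] : Set (Pt K) := {P | P.rep 2 = 0}

/-- The invertible linear map `(x, y, z) ↦ (x, y + tz, z)` of `K³`. -/
def elationEquiv (K : Type) [Field K] (t : K) : (Fin 3 → K) ≃ₗ[K] (Fin 3 → K) where
  toFun v := ![v 0, v 1 + t * v 2, v 2]
  invFun v := ![v 0, v 1 - t * v 2, v 2]
  map_add' u v := by
    ext i
    fin_cases i <;> simp <;> ring
  map_smul' c v := by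
    ext i
    fin_cases i <;> simp <;> ring
  left_inv v := by
    ext i
    fin_cases i <;> simp
  right_inv v := by
    ext i
    fin_cases i <;> simp

/-- The elation `E_t` of `PG(2, q²)` induced by `(x, y, z) ↦ (x, y + tz, z)`. -/
def elation (K : Type) [Field K] (t : K) : Pt K → Pt K :=
  Projectivization.map (elationEquiv K t).toLinearMap (elationEquiv K t).injective

section Involution

variable {K : Type} [Field K] {σ : K →+* K} {α β : K}

/-- The quadratic form `u ↦ z - σ z` with `z = α u² + β u (σ u)` is anisotropic. -/
lemma anisotropic_of_not_square (hσ : ∀ x, σ (σ x) = x)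
    (hns : ∀ s, σ s = s → 4 * (σ α * α) + (σ β - β) ^ 2 ≠ s ^ 2) {u : K} (hu : u ≠ 0) :
    α * u ^ 2 - σ α * σ u ^ 2 + (β - σ β) * (σ u * u) ≠ 0 := by
  intro h
  have hσu : σ u ≠ 0 := (map_ne_zero σ).2 hu
  refine hns ((α * u ^ 2 + σ α * σ u ^ 2) / (σ u * u)) ?_ ?_
  · simp only [map_div₀, map_add, map_mul, map_pow, hσ]
    rw [add_comm, mul_comm u]
  · rw [div_pow, eq_div_iff (by positivity)]
    linear_combination (-(α * u ^ 2 - σ α * σ u ^ 2) + (β - σ β) * (σ u * u)) * h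

lemma exists_linear_eq_quadratic (hσ : ∀ x, σ (σ x) = x)
    (hns : ∀ s, σ s = s → 4 * (σ α * α) + (σ β - β) ^ 2 ≠ s ^ 2) {c : K} (hc : c ≠ 0) :
    ∃ u ≠ 0, c * u - σ (c * u) =
      α * u ^ 2 - σ α * σ u ^ 2 + (β - σ β) * (σ u * u) := by
  obtain ⟨e, he⟩ : ∃ e, σ e ≠ e := by
    by_contra! hfix
    refine hns (2 * α) (hfix _) ?_
    rw [hfix, hfix]
    ring
  have he0 : e ≠ 0 := by
    rintro rfl
    exact he (map_zero σ)
  set v := e / c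
  have hv0 : v ≠ 0 := div_ne_zero he0 hc
  have hcv : c * v = e := mul_div_cancel₀ e hc
  set Q := α * v ^ 2 - σ α * σ v ^ 2 + (β - σ β) * (σ v * v) with hQ
  have hQ0 : Q ≠ 0 := anisotropic_of_not_square hσ hns hv0
  have hσQ : σ Q = -Q := by
    simp only [hQ, map_add, map_sub, map_mul, map_pow, hσ]
    ring
  have hl : σ ((e - σ e) / Q) = (e - σ e) / Q := by
    rw [map_div₀, map_sub, hσ, hσQ, ← neg_sub, neg_div_neg_eq]
  refine ⟨(e - σ e) / Q * v, mul_ne_zero (div_ne_zero (sub_ne_zero.2 he.symm) hQ0) hv0, ?_⟩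
  rw [mul_left_comm, hcv]
  simp only [map_mul, hl]
  have : (e - σ e) / Q * Q = e - σ e := div_mul_cancel₀ _ hQ0
  linear_combination -((e - σ e) / Q) * this + ((e - σ e) / Q) ^ 2 * hQ

/-- A line of slope `m` through an affine point of the unital above `x` meets the unital in a
second affine point unless `m = 2 α x + (β - σ β) σ x`. -/
lemma exists_second_affine_point (hσ : ∀ x, σ (σ x) = x)
    (hns : ∀ s, σ s = s → 4 * (σ α * α) + (σ β - β) ^ 2 ≠ s ^ 2) {m x y : K}
    (hy : σ (y - (α * x ^ 2 + β * (σ x * x))) = y - (α * x ^ 2 + β * (σ x * x)))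
    (hm : m ≠ 2 * α * x + (β - σ β) * σ x) :
    ∃ u ≠ 0, σ (y + m * u - (α * (x + u) ^ 2 + β * (σ (x + u) * (x + u)))) =
      y + m * u - (α * (x + u) ^ 2 + β * (σ (x + u) * (x + u))) := by
  obtain ⟨u, hu, h⟩ := exists_linear_eq_quadratic hσ hns (sub_ne_zero.2 hm)
  refine ⟨u, hu, ?_⟩
  simp only [map_add, map_sub, map_mul, map_pow, map_ofNat, hσ] at h hy ⊢
  linear_combination hy - h

end Involution

section Plane

variable {K : Type} [Field K]

lemma mk_mem_lineThrough {u v w : Fin 3 → K} (hu : u ≠ 0) (hv : v ≠ 0) (hw : w ≠ 0) (a b : K)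
    (h : w = a • u + b • v) :
    mk K w hw ∈ lineThrough (mk K u hu) (mk K v hv) := by
  simp only [lineThrough, Set.mem_ofPred_eq, submodule_mk, Submodule.span_singleton_le_iff_mem]
  rw [h]
  exact Submodule.add_mem_sup
    (Submodule.smul_mem _ _ (Submodule.mem_span_singleton_self _))
    (Submodule.smul_mem _ _ (Submodule.mem_span_singleton_self _))

lemma mk_affine_inj {a b x y : K} :
    mk K ![a, b, 1] (vec1_ne_zero a b) = mk K ![x, y, 1] (vec1_ne_zero x y) ↔
      a = x ∧ b = y := by
  refine ⟨fun h => ?_, by rintro ⟨rfl, rfl⟩; rfl⟩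
  obtain ⟨c, hc⟩ := (mk_eq_mk_iff' K _ _ _ _).1 h
  have h0 := congrFun hc 0
  have h1 := congrFun hc 1
  have h2 := congrFun hc 2
  simp at h0 h1 h2
  subst h2
  simp at h0 h1
  exact ⟨h0.symm, h1.symm⟩

lemma mk_affine_ne_mk_inf {a b : K} :
    mk K ![a, b, 1] (vec1_ne_zero a b) ≠ mk K ![0, 1, 0] vecInf_ne_zero := by
  intro h
  obtain ⟨c, hc⟩ := (mk_eq_mk_iff' K _ _ _ _).1 h
  have h2 := congrFun hc 2
  simp at h2

lemma exists_eq_mk_affine {P : Pt K} (hP : P ∉ linf K) :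
    ∃ a b : K, P = mk K ![a, b, 1] (vec1_ne_zero a b) := by
  have h2 : P.rep 2 ≠ 0 := hP
  refine ⟨P.rep 0 / P.rep 2, P.rep 1 / P.rep 2, ?_⟩
  rw [← mk_rep P, mk_eq_mk_iff']
  refine ⟨P.rep 2, ?_⟩
  rw [mk_rep]
  ext i
  fin_cases i <;> simp [mul_div_cancel₀, h2]

lemma elation_mk_affine (t a b : K) :
    elation K t (mk K ![a, b, 1] (vec1_ne_zero a b)) =
      mk K ![a, b + t, 1] (vec1_ne_zero a (b + t)) := by
  rw [elation, map_mk, mk_eq_mk_iff']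
  refine ⟨1, ?_⟩
  ext i
  fin_cases i <;> simp [elationEquiv]

variable {q : ℕ} {α β : K}

lemma mk_inf_mem_unital : mk K ![0, 1, 0] vecInf_ne_zero ∈ unital K q α β := Or.inr rfl

lemma eq_mk_of_mem_unital {A : Pt K} (hA : A ∈ unital K q α β) :
    (∃ x y, A = mk K ![x, y, 1] (vec1_ne_zero x y)) ∨ A = mk K ![0, 1, 0] vecInf_ne_zero :=
  hA.imp_left fun ⟨x, _, _, h⟩ => ⟨x, _, h⟩

lemma mk_affine_mem_unital {a b : K} :
    mk K ![a, b, 1] (vec1_ne_zero a b) ∈ unital K q α β ↔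
      (b - (α * a ^ 2 + β * a ^ (q + 1))) ^ q = b - (α * a ^ 2 + β * a ^ (q + 1)) := by
  constructor
  · rintro (⟨x, r, hr, h⟩ | h)
    · obtain ⟨rfl, rfl⟩ := mk_affine_inj.1 h
      simpa using hr
    · exact (mk_affine_ne_mk_inf h).elim
  · intro h
    exact Or.inl ⟨a, _, h, mk_affine_inj.2 ⟨rfl, by ring⟩⟩

/-- The feet of an affine point `[a, b, 1]` off the unital are affine, and the slope of the
line joining the point to a foot above `x` is `2 α x + (β - β̄) x̄`. -/
lemma exists_slope_of_mem_pedal {σ : K →+* K} (hpow : ∀ x, σ x = x ^ q) (hq : q ≠ 0)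
    (hσ : ∀ x, σ (σ x) = x)
    (hns : ∀ s, σ s = s → 4 * (σ α * α) + (σ β - β) ^ 2 ≠ s ^ 2) {a b : K}
    (hP : mk K ![a, b, 1] (vec1_ne_zero a b) ∉ unital K q α β) {A : Pt K}
    (hA : A ∈ pedal (unital K q α β) (mk K ![a, b, 1] (vec1_ne_zero a b))) :
    ∃ x y, A = mk K ![x, y, 1] (vec1_ne_zero x y) ∧
      b - y = (2 * α * x + (β - σ β) * σ x) * (a - x) := by
  obtain ⟨hAU, hline⟩ := hA
  have huniq : ∀ C ∈ lineThrough (mk K ![a, b, 1] (vec1_ne_zero a b)) A,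
      C ∈ unital K q α β → C = A := fun C hC hCU => hline.subset ⟨hC, hCU⟩
  rcases eq_mk_of_mem_unital hAU with ⟨x, y, rfl⟩ | rfl
  · refine ⟨x, y, rfl, ?_⟩
    by_cases hax : a = x
    · subst hax
      have hby : b - y ≠ 0 := by
        intro h
        rw [sub_eq_zero] at h
        exact hP (by rwa [h])
      refine (mk_affine_ne_mk_inf (huniq _ (mk_mem_lineThrough _ _ vecInf_ne_zero
        (b - y)⁻¹ (-(b - y)⁻¹) ?_) mk_inf_mem_unital).symm).elim
      ext i
      fin_cases i
      · simp
      · simp [← sub_eq_add_neg, ← mul_sub, hby]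
      · simp
    · have hax' : a - x ≠ 0 := sub_ne_zero.2 hax
      rw [← div_eq_iff hax']
      by_contra hm
      have hAU' := mk_affine_mem_unital.1 hAU
      rw [pow_succ _ q, ← hpow, ← hpow] at hAU'
      obtain ⟨u, hu, h⟩ := exists_second_affine_point hσ hns hAU' hm
      have hmem : mk K ![x + u, y + (b - y) / (a - x) * u, 1] (vec1_ne_zero _ _) ∈
          unital K q α β := by
        rw [mk_affine_mem_unital, pow_succ _ q, ← hpow, ← hpow]
        exact h
      refine hu (add_eq_left.1 (mk_affine_inj.1 (huniq _ (mk_mem_lineThrough _ _ _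
        (u / (a - x)) (1 - u / (a - x)) ?_) hmem)).1)
      ext i
      fin_cases i
      · simp; field_simp; ring
      · simp; field_simp; ring
      · simp
  · refine (mk_affine_ne_mk_inf (huniq (mk K ![a, α * a ^ 2 + β * a ^ (q + 1), 1]
      (vec1_ne_zero _ _)) (mk_mem_lineThrough _ _ _ 1 (α * a ^ 2 + β * a ^ (q + 1) - b) ?_)
      (mk_affine_mem_unital.2 (by simp [hq])))).elim
    ext i
    fin_cases i <;> simp

end Plane

theorem stmt_18 {K : Type} [Field K] [Fintype K] (p n q : ℕ)
    (hp : p.Prime) (hpodd : Odd p) (hn : 0 < n) (hq : q = p ^ n)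
    (hcard : Fintype.card K = q ^ 2)
    (α β : K) (hα : α ≠ 0)
    (hns : ¬ ∃ s : K, s ^ q = s ∧ 4 * α ^ (q + 1) + (β ^ q - β) ^ 2 = s ^ 2)
    (P : Pt K) (hP : P ∉ unital K q α β) (hPl : P ∉ linf K)
    (t : K) (ht : t ^ q = t) (ht0 : t ≠ 0) :
    elation K t P ∉ unital K q α β ∧
    Disjoint (pedal (unital K q α β) P) (pedal (unital K q α β) (elation K t P)) := by
  have : Fact p.Prime := ⟨hp⟩
  have : CharP K p := charP_of_card_eq_prime_pow (f := n * 2) (by rw [hcard, hq, pow_mul])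
  have hpow : ∀ x, iterateFrobenius K p n x = x ^ q := fun x => by
    rw [iterateFrobenius_def, hq]
  generalize iterateFrobenius K p n = σ at hpow
  have hσ : ∀ x, σ (σ x) = x := fun x => by
    rw [hpow, hpow, ← pow_mul, ← sq, ← hcard, FiniteField.pow_card]
  have hns' : ∀ s, σ s = s → 4 * (σ α * α) + (σ β - β) ^ 2 ≠ s ^ 2 := by
    intro s hs h
    refine hns ⟨s, by rwa [← hpow], ?_⟩
    rwa [pow_succ _ q, ← hpow, ← hpow]
  have hq0 : q ≠ 0 := hq ▸ pow_ne_zero n hp.ne_zero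
  obtain ⟨a, b, rfl⟩ := exists_eq_mk_affine hPl
  rw [elation_mk_affine]
  have hEP : mk K ![a, b + t, 1] (vec1_ne_zero a (b + t)) ∉ unital K q α β := by
    rw [mk_affine_mem_unital, ← hpow] at hP ⊢
    rw [← hpow] at ht
    intro h
    rw [add_sub_right_comm, map_add, ht] at h
    exact hP (add_right_cancel h)
  refine ⟨hEP, Set.disjoint_left.2 fun A hA hA' => ht0 ?_⟩
  obtain ⟨x, y, rfl, h⟩ := exists_slope_of_mem_pedal hpow hq0 hσ hns' hP hA
  obtain ⟨x', y', hxy, h'⟩ := exists_slope_of_mem_pedal hpow hq0 hσ hns' hEP hA'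
  obtain ⟨rfl, rfl⟩ := mk_affine_inj.1 hxy
  linear_combination h' - h
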